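/- Let k be a field and A a Hopf algebra over k. Let U ⊆ A ⊗ₖ A be the k-linear span of the elements Σ x·c₍₁₎ ⊗ S(c₍₂₎)·y − ε(c)·(x ⊗ y), for x, y, c ∈ A. Then the multiplication map m : A ⊗ₖ A → A, x ⊗ y ↦ xy, is surjective with kernel exactly U, and it satisfies m(ax ⊗ yb) = a·m(x ⊗ y)·b; hence m induces an isomorphism of A-bimodules (A ⊗ₖ A)/U ≅ A, where A ⊗ₖ A carries the bimodule structure a·(x ⊗ y)·b = ax ⊗ yb and A the regular bimodule structure. -/

import Mathlib

open TensorProduct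

/-- For `c : A`, the `k`-linear endomorphism `z ↦ z ⋆ c` of `A ⊗ₖ A` determined by
`(x ⊗ y) ⋆ c = Σ x·c₍₁₎ ⊗ S(c₍₂₎)·y`. -/
noncomputable def starAct (k A : Type*) [Field k] [Ring A] [HopfAlgebra k A] (c : A) :
    A ⊗[k] A →ₗ[k] A ⊗[k] A :=
  TensorProduct.map
      (LinearMap.mul' k A ∘ₗ (TensorProduct.comm k A A).toLinearMap)
      (LinearMap.mul' k A ∘ₗ TensorProduct.map (HopfAlgebra.antipode (R := k)) LinearMap.id) ∘ₗ
    (TensorProduct.tensorTensorTensorComm k A A A A).toLinearMap ∘ₗ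
    TensorProduct.mk k (A ⊗[k] A) (A ⊗[k] A) (Coalgebra.comul c)

/-- The `k`-linear span `U` of the elements
`Σ x·c₍₁₎ ⊗ S(c₍₂₎)·y − ε(c)·(x ⊗ y)` for `x, y, c ∈ A`. -/
noncomputable def augRelations (k A : Type*) [Field k] [Ring A] [HopfAlgebra k A] :
    Submodule k (A ⊗[k] A) :=
  Submodule.span k
    {u : A ⊗[k] A | ∃ x y c : A,
      u = starAct k A c (x ⊗ₜ[k] y) - Coalgebra.counit (R := k) c • (x ⊗ₜ[k] y)}

theorem starAct_repr (k A : Type*) [Field k] [Ring A] [HopfAlgebra k A] {ι : Type*} (c x y : A)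
    (r : Coalgebra.Repr k c ι) :
    starAct k A c (x ⊗ₜ[k] y) =
      ∑ i ∈ r.index, (x * r.left i) ⊗ₜ[k] (HopfAlgebra.antipode k (r.right i) * y) := by
  simp only [starAct, LinearMap.comp_apply, TensorProduct.mk_apply]
  rw [← r.eq]
  simp [TensorProduct.sum_tmul]

theorem tmul_sub_mem (k A : Type*) [Field k] [Ring A] [HopfAlgebra k A] (c y : A) :
    c ⊗ₜ[k] y - (1 : A) ⊗ₜ[k] (c * y) ∈ augRelations k A := by
  let r := Coalgebra.Repr.arbitrary k c
  let l := fun i => Coalgebra.Repr.arbitrary k (r.left i)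
  let q := fun i => Coalgebra.Repr.arbitrary k (r.right i)
  have h1 : ∑ i ∈ r.index, starAct k A (r.left i) (1 ⊗ₜ[k] (r.right i * y)) = c ⊗ₜ[k] y := by
    let F : A ⊗[k] (A ⊗[k] A) →ₗ[k] A ⊗[k] A :=
      LinearMap.lTensor A (LinearMap.mulRight k y ∘ₗ LinearMap.mul' k A ∘ₗ
        LinearMap.rTensor A (HopfAlgebra.antipode k))
    have h := congrArg F (Coalgebra.sum_tmul_tmul_eq r l q)
    simp only [map_sum, F, LinearMap.lTensor_tmul, LinearMap.rTensor_tmul, LinearMap.comp_apply,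
      LinearMap.mul'_apply, LinearMap.mulRight_apply] at h
    simp only [fun i => starAct_repr k A (r.left i) 1 (r.right i * y) (l i), one_mul, ← mul_assoc]
    rw [h]
    simp only [← TensorProduct.tmul_sum, ← Finset.sum_mul]
    simp only [fun i => HopfAlgebra.sum_antipode_mul_eq_smul (q i)]
    have h2 := congrArg (LinearMap.lTensor A (LinearMap.toSpanSingleton k A y))
      (Coalgebra.sum_tmul_counit_eq r)
    simp only [map_sum, LinearMap.lTensor_tmul, LinearMap.toSpanSingleton_apply, one_smul] at h2
    simpa only [smul_mul_assoc, one_mul] using h2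
  have h3 : ∑ i ∈ r.index, Coalgebra.counit (R := k) (r.left i) • ((1 : A) ⊗ₜ[k] (r.right i * y)) =
      (1 : A) ⊗ₜ[k] (c * y) := by
    have h := congrArg (fun t => (1 : A) ⊗ₜ[k] (t * y)) (Coalgebra.sum_counit_smul r)
    simpa [Finset.sum_mul, TensorProduct.tmul_sum] using h
  rw [← h1, ← h3, ← Finset.sum_sub_distrib]
  exact Submodule.sum_mem _ fun i _ => Submodule.subset_span ⟨_, _, _, rfl⟩

theorem sub_mul_mem (k A : Type*) [Field k] [Ring A] [HopfAlgebra k A] (z : A ⊗[k] A) :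
    z - (1 : A) ⊗ₜ[k] (LinearMap.mul' k A z) ∈ augRelations k A := by
  induction z with
  | zero => simp
  | tmul x y => simpa using tmul_sub_mem k A x y
  | add a b ha hb =>
    rw [map_add, TensorProduct.tmul_add, add_sub_add_comm]
    exact Submodule.add_mem _ ha hb

theorem ker_eq_aux (k A : Type*) [Field k] [Ring A] [HopfAlgebra k A] :
    LinearMap.ker (LinearMap.mul' k A) = augRelations k A := by
  apply le_antisymm
  · intro z hz
    have h := sub_mul_mem k A z
    rw [LinearMap.mem_ker.1 hz] at h
    simpa using h
  · refine Submodule.span_le.2 ?_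
    rintro _ ⟨x, y, c, rfl⟩
    let r := Coalgebra.Repr.arbitrary k c
    have h := congrArg (fun t => x * t * y) (HopfAlgebra.sum_mul_antipode_eq_smul r)
    simp only [Finset.mul_sum, Finset.sum_mul] at h
    rw [SetLike.mem_coe, LinearMap.mem_ker, starAct_repr k A c x y r, map_sub, map_sum, sub_eq_zero]
    simpa [mul_assoc] using h

/-- the multiplication map `m : A ⊗ₖ A → A` is surjective with kernel
exactly `U`, satisfies `m(ax ⊗ yb) = a·m(x ⊗ y)·b`, and hence induces an isomorphism
of `A`-bimodules `(A ⊗ₖ A)/U ≅ A`. -/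
theorem mul'_ker_augRelations (k A : Type*) [Field k] [Ring A] [HopfAlgebra k A] :
    Function.Surjective ⇑(LinearMap.mul' k A) ∧
    LinearMap.ker (LinearMap.mul' k A) = augRelations k A ∧
    (∀ a b x y : A, LinearMap.mul' k A ((a * x) ⊗ₜ[k] (y * b)) =
      a * LinearMap.mul' k A (x ⊗ₜ[k] y) * b) ∧
    ∃ e : ((A ⊗[k] A) ⧸ augRelations k A) ≃ₗ[k] A,
      (∀ z : A ⊗[k] A, e (Submodule.Quotient.mk z) = LinearMap.mul' k A z) ∧
      ∀ a b x y : A,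
        e (Submodule.Quotient.mk ((a * x) ⊗ₜ[k] (y * b))) =
          a * e (Submodule.Quotient.mk (x ⊗ₜ[k] y)) * b := by
  have hs : Function.Surjective ⇑(LinearMap.mul' k A) := fun a => ⟨1 ⊗ₜ a, by simp⟩
  have hm : ∀ a b x y : A, LinearMap.mul' k A ((a * x) ⊗ₜ[k] (y * b)) =
      a * LinearMap.mul' k A (x ⊗ₜ[k] y) * b := fun a b x y => by simp [mul_assoc]
  refine ⟨hs, ker_eq_aux k A, hm, ?_⟩
  let e := (Submodule.quotEquivOfEq _ _ (ker_eq_aux k A).symm).trans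
    ((LinearMap.mul' k A).quotKerEquivOfSurjective hs)
  have he : ∀ z : A ⊗[k] A, e (Submodule.Quotient.mk z) = LinearMap.mul' k A z := fun z => rfl
  refine ⟨e, he, fun a b x y => ?_⟩
  rw [he, he, hm]
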